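/- arXiv:2101.06361 — 4 statements merged into one kernel-verified Lean document; each statement's English description precedes it below -/
import Mathlib

section
/- Let G be a multigraph containing a coin u of degree 2 such that one string of u joins u to a coin of degree 1, and the other string of u either has its second endpoint on the ground or joins u to a coin of degree at least 2. Then the first player has a winning strategy in Nimstring on G. (Such positions are called loony.) -/
/-- A multigraph of coins and strings: `V` is the set of coins, `E` the set of
string identifiers (identifiers model the multiset of edges), and `ends e` is the
set of (at most two) coin endpoints of string `e`; endpoints of a string missing
from `ends e` are attached to the ground. -/
structure Multigraph where
  V : Finset ℕ
  E : Finset ℕ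
  ends : ℕ → Finset ℕ
  ends_sub : ∀ e ∈ E, ends e ⊆ V
  ends_card : ∀ e ∈ E, (ends e).card ≤ 2

namespace Multigraph

/-- The coins freed by removing string `e` from the position `S` (the set of
remaining strings): the endpoints of `e` having no other incident string in `S`. -/
def freed (G : Multigraph) (S : Finset ℕ) (e : ℕ) : Finset ℕ :=
  (G.ends e).filter fun v => ∀ f ∈ S.erase e, v ∉ G.ends f

/-- The number of coins freed by removing string `e` from position `S`. -/
def freedCount (G : Multigraph) (S : Finset ℕ) (e : ℕ) : ℕ := (G.freed S e).card

/-- The degree of a coin `v`: the number of strings of `G` incident to `v`. -/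
def degree (G : Multigraph) (v : ℕ) : ℕ := (G.E.filter fun e => v ∈ G.ends e).card

/-- Nimstring: the player to move from position `S` has a winning strategy.
A move freeing a coin keeps the turn with the same player; the first player
unable to move loses (normal play). -/
def NimWin (G : Multigraph) (S : Finset ℕ) : Prop :=
  ∃ e, ∃ _h : e ∈ S,
    ((0 < G.freedCount S e ∧ NimWin G (S.erase e)) ∨
     (G.freedCount S e = 0 ∧ ¬ NimWin G (S.erase e)))
termination_by S.card
decreasing_by all_goals exact Finset.card_erase_lt_of_mem _h

end Multigraph

namespace Multigraph

theorem nimWin_iff (G : Multigraph) (S : Finset ℕ) :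
    G.NimWin S ↔ ∃ e ∈ S, (0 < G.freedCount S e ∧ G.NimWin (S.erase e)) ∨
      (G.freedCount S e = 0 ∧ ¬ G.NimWin (S.erase e)) := by
  rw [NimWin]
  simp only [exists_prop]

theorem freedCount_pos_of_forall_notMem {G : Multigraph} {S : Finset ℕ} {e v : ℕ}
    (hv : v ∈ G.ends e) (h : ∀ f ∈ S.erase e, v ∉ G.ends f) : 0 < G.freedCount S e :=
  Finset.card_pos.2 ⟨v, Finset.mem_filter.2 ⟨hv, h⟩⟩

theorem freedCount_eq_zero {G : Multigraph} {S : Finset ℕ} {e : ℕ}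
    (h : ∀ v ∈ G.ends e, ∃ f ∈ S.erase e, v ∈ G.ends f) : G.freedCount S e = 0 := by
  rw [freedCount, Finset.card_eq_zero, freed, Finset.filter_eq_empty_iff]
  intro v hv hfree
  obtain ⟨f, hf, hvf⟩ := h v hv
  exact hfree f hf hvf

/-- Erasing a string that shares no coin with `e` does not change the coins freed by `e`. -/
theorem freedCount_erase_of_disjoint {G : Multigraph} {S : Finset ℕ} {a e : ℕ}
    (h : ∀ v ∈ G.ends e, v ∉ G.ends a) :
    G.freedCount (S.erase a) e = G.freedCount S e := by
  unfold freedCount freed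
  congr 1
  refine Finset.filter_congr fun v hv => ?_
  have hva := h v hv
  simp only [Finset.mem_erase]
  constructor
  · intro hfree f hf hvf
    have hfa : f ≠ a := fun hfa => hva (hfa ▸ hvf)
    exact hfree f ⟨hf.1, hfa, hf.2⟩ hvf
  · exact fun hfree f hf => hfree f ⟨hf.1, hf.2.2⟩

/-- A string with at least one coin, sharing no coin with the other strings, does not
affect who wins. -/
theorem nimWin_erase_iff_of_isolated {G : Multigraph} {a : ℕ} (hne : (G.ends a).Nonempty)
    (S : Finset ℕ) (ha : a ∈ S) (h : ∀ f ∈ S.erase a, ∀ v ∈ G.ends a, v ∉ G.ends f) :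
    G.NimWin (S.erase a) ↔ G.NimWin S := by
  induction S using Finset.strongInduction with
  | H S ih =>
    have key : ∀ e ∈ S.erase a, G.freedCount (S.erase a) e = G.freedCount S e ∧
        (G.NimWin ((S.erase a).erase e) ↔ G.NimWin (S.erase e)) := by
      intro e he
      obtain ⟨hea, heS⟩ := Finset.mem_erase.1 he
      refine ⟨freedCount_erase_of_disjoint fun v hv hva => h e he v hva hv, ?_⟩
      rw [Finset.erase_right_comm]
      refine ih _ (Finset.erase_ssubset heS) (Finset.mem_erase.2 ⟨hea.symm, ha⟩) ?_
      exact fun f hf => h f (Finset.erase_subset_erase _ (Finset.erase_subset _ _) hf)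
    obtain ⟨v, hv⟩ := hne
    have hpos : 0 < G.freedCount S a :=
      freedCount_pos_of_forall_notMem hv fun f hf => h f hf v hv
    constructor
    · exact fun hw => (nimWin_iff G S).2 ⟨a, ha, Or.inl ⟨hpos, hw⟩⟩
    · intro hw
      obtain ⟨e, he, hmove⟩ := (nimWin_iff G S).1 hw
      by_cases hea : e = a
      · subst hea
        rcases hmove with hmove | hmove
        · exact hmove.2
        · exact absurd hmove.1 hpos.ne'
      · have heS := Finset.mem_erase.2 ⟨hea, he⟩
        refine (nimWin_iff G _).2 ⟨e, heS, ?_⟩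
        rwa [(key e heS).1, (key e heS).2]

theorem eq_of_mem_ends_of_degree_eq_one {G : Multigraph} {v e f : ℕ} (hdeg : G.degree v = 1)
    (he : e ∈ G.E) (hve : v ∈ G.ends e) (hf : f ∈ G.E) (hvf : v ∈ G.ends f) : f = e :=
  Finset.card_le_one.1 hdeg.le f (Finset.mem_filter.2 ⟨hf, hvf⟩) e
    (Finset.mem_filter.2 ⟨he, hve⟩)

theorem eq_or_eq_of_mem_ends_of_degree_eq_two {G : Multigraph} {v a b f : ℕ}
    (hdeg : G.degree v = 2) (hab : a ≠ b) (ha : a ∈ G.E) (hva : v ∈ G.ends a)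
    (hb : b ∈ G.E) (hvb : v ∈ G.ends b) (hf : f ∈ G.E) (hvf : v ∈ G.ends f) :
    f = a ∨ f = b := by
  have hsub : ({a, b} : Finset ℕ) ⊆ G.E.filter fun e => v ∈ G.ends e := by
    simp [Finset.insert_subset_iff, *]
  have heq := Finset.eq_of_subset_of_card_le hsub
    (by rw [Finset.card_pair hab]; exact hdeg.le)
  have hmem : f ∈ ({a, b} : Finset ℕ) := heq ▸ Finset.mem_filter.2 ⟨hf, hvf⟩
  simpa using hmem

theorem exists_mem_ends_of_two_le_degree {G : Multigraph} {v : ℕ} (hdeg : 2 ≤ G.degree v)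
    (e : ℕ) : ∃ f ∈ G.E.erase e, v ∈ G.ends f := by
  obtain ⟨f, hf, hfe⟩ := Finset.exists_mem_ne hdeg e
  obtain ⟨hfE, hvf⟩ := Finset.mem_filter.1 hf
  exact ⟨f, Finset.mem_erase.2 ⟨hfe, hfE⟩, hvf⟩

end Multigraph

/-- Loony positions: let `G` contain a coin `u` of degree `2` whose two strings
are `a` and `b`, where `a` joins `u` to a coin `w` of degree `1`, and `b` either
has its second endpoint on the ground or joins `u` to a coin `z` of degree at
least `2`.  Then the first player has a winning strategy in Nimstring on `G`. -/
theorem loony_first_player_wins_nimstring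
    (G : Multigraph) (u w a b : ℕ)
    (hu : u ∈ G.V) (hw : w ∈ G.V)
    (ha : a ∈ G.E) (hb : b ∈ G.E) (hab : a ≠ b)
    (hdeg_u : G.degree u = 2)
    (hua : u ∈ G.ends a) (hub : u ∈ G.ends b)
    (huw : u ≠ w)
    (hends_a : G.ends a = {u, w}) (hdeg_w : G.degree w = 1)
    (hb' : G.ends b = {u} ∨
      ∃ z ∈ G.V, z ≠ u ∧ G.ends b = {u, z} ∧ 2 ≤ G.degree z) :
    G.NimWin G.E := by
  have hwa : w ∈ G.ends a := by simp [hends_a]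
  have hu_only : ∀ f ∈ G.E, u ∈ G.ends f → f = a ∨ f = b := fun f hf huf =>
    Multigraph.eq_or_eq_of_mem_ends_of_degree_eq_two hdeg_u hab ha hua hb hub hf huf
  have hw_only : ∀ f ∈ G.E, w ∈ G.ends f → f = a := fun f hf hwf =>
    Multigraph.eq_of_mem_ends_of_degree_eq_one hdeg_w ha hwa hf hwf
  have ha_mem : a ∈ G.E.erase b := Finset.mem_erase.2 ⟨hab, ha⟩
  have hb_mem : b ∈ G.E.erase a := Finset.mem_erase.2 ⟨hab.symm, hb⟩
  by_cases hR : G.NimWin ((G.E.erase a).erase b)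
  · -- Take both strings, keeping the turn each time.
    refine (G.nimWin_iff _).2 ⟨a, ha, Or.inl ⟨?_, (G.nimWin_iff _).2 ⟨b, hb_mem, Or.inl ⟨?_, hR⟩⟩⟩⟩
    · refine Multigraph.freedCount_pos_of_forall_notMem hwa fun f hf hwf => ?_
      exact Finset.ne_of_mem_erase hf (hw_only f (Finset.mem_of_mem_erase hf) hwf)
    · refine Multigraph.freedCount_pos_of_forall_notMem hub fun f hf huf => ?_
      simp only [Finset.mem_erase] at hf
      exact (hu_only f hf.2.2 huf).elim hf.2.1 hf.1
  · -- Take `b` only, leaving the isolated string `a` to the opponent.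
    refine (G.nimWin_iff _).2 ⟨b, hb, Or.inr ⟨?_, ?_⟩⟩
    · refine Multigraph.freedCount_eq_zero fun v hv => ?_
      rcases hb' with hends | ⟨z, _, _, hends, hz⟩
      · obtain rfl : v = u := by simpa [hends] using hv
        exact ⟨a, ha_mem, hua⟩
      · rw [hends, Finset.mem_insert, Finset.mem_singleton] at hv
        rcases hv with rfl | rfl
        · exact ⟨a, ha_mem, hua⟩
        · exact Multigraph.exists_mem_ends_of_two_le_degree hz b
    · rw [← Multigraph.nimWin_erase_iff_of_isolated ⟨u, hua⟩ _ ha_mem, Finset.erase_right_comm]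
      · exact hR
      · intro f hf v hv hvf
        simp only [Finset.mem_erase] at hf
        rw [hends_a, Finset.mem_insert, Finset.mem_singleton] at hv
        rcases hv with rfl | rfl
        · exact (hu_only f hf.2.2 hvf).elim hf.1 hf.2.1
        · exact hf.1 (hw_only f hf.2.2 hvf)
end

section
/- Let G be a multigraph and let H be obtained from G by adding two new coins a, b and a single new string joining a and b. Then the first player has a winning strategy in Nimstring on H if and only if the first player has a winning strategy in Nimstring on G. -/
namespace Multigraph

/-- The freed coins depend only on the endpoints of the remaining strings. -/
theorem freedCount_congr {G H : Multigraph} {S : Finset ℕ} (h : ∀ f ∈ S, H.ends f = G.ends f)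
    {e : ℕ} (he : e ∈ S) : H.freedCount S e = G.freedCount S e := by
  unfold freedCount freed
  rw [h e he]
  congr 1
  refine Finset.filter_congr fun v _ => forall₂_congr fun f hf => ?_
  rw [h f (Finset.mem_of_mem_erase hf)]

/-- The outcome depends only on the endpoints of the remaining strings. -/
theorem nimWin_congr {G H : Multigraph} (S : Finset ℕ) (h : ∀ f ∈ S, H.ends f = G.ends f) :
    H.NimWin S ↔ G.NimWin S := by
  induction S using Finset.strongInduction with
  | H S ih =>
    rw [NimWin.eq_def H, NimWin.eq_def G]
    refine exists₂_congr fun e he => ?_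
    rw [freedCount_congr h he,
      ih _ (Finset.erase_ssubset he) fun f hf => h f (Finset.mem_of_mem_erase hf)]

/-- A string sharing no coin with `e` does not affect what removing `e` frees. -/
theorem freedCount_insert_of_disjoint (G : Multigraph) {S : Finset ℕ} {e e₀ : ℕ} (hne : e₀ ≠ e)
    (hd : Disjoint (G.ends e₀) (G.ends e)) :
    G.freedCount (insert e₀ S) e = G.freedCount S e := by
  unfold freedCount freed
  congr 1
  refine Finset.filter_congr fun v hv => ?_
  rw [Finset.erase_insert_of_ne hne, Finset.forall_mem_insert]
  exact and_iff_right (Finset.disjoint_right.mp hd hv)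

/-- Removing a string that shares no coin with the others frees all its endpoints. -/
theorem freedCount_insert_self (G : Multigraph) {S : Finset ℕ} {e₀ : ℕ} (he₀ : e₀ ∉ S)
    (hd : ∀ f ∈ S, Disjoint (G.ends e₀) (G.ends f)) :
    G.freedCount (insert e₀ S) e₀ = (G.ends e₀).card := by
  unfold freedCount freed
  rw [Finset.erase_insert he₀, Finset.filter_true_of_mem]
  exact fun v hv f hf => Finset.disjoint_left.mp (hd f hf) hv

/-- A string with a coin endpoint, sharing no coin with the others, does not affect the outcome. -/
theorem nimWin_insert_of_disjoint (G : Multigraph) {e₀ : ℕ} (hne : (G.ends e₀).Nonempty)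
    (S : Finset ℕ) (he₀ : e₀ ∉ S) (hd : ∀ f ∈ S, Disjoint (G.ends e₀) (G.ends f)) :
    G.NimWin (insert e₀ S) ↔ G.NimWin S := by
  induction S using Finset.strongInduction with
  | H S ih =>
    have move_iff : ∀ e ∈ S,
        ((0 < G.freedCount (insert e₀ S) e ∧ G.NimWin ((insert e₀ S).erase e)) ∨
          (G.freedCount (insert e₀ S) e = 0 ∧ ¬ G.NimWin ((insert e₀ S).erase e))) ↔
        ((0 < G.freedCount S e ∧ G.NimWin (S.erase e)) ∨
          (G.freedCount S e = 0 ∧ ¬ G.NimWin (S.erase e))) := by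
      intro e he
      have hee : e₀ ≠ e := fun h => he₀ (h ▸ he)
      rw [freedCount_insert_of_disjoint G hee (hd e he), Finset.erase_insert_of_ne hee,
        ih _ (Finset.erase_ssubset he) (fun h => he₀ (Finset.mem_of_mem_erase h))
          fun f hf => hd f (Finset.mem_of_mem_erase hf)]
    have hpos : 0 < G.freedCount (insert e₀ S) e₀ := by
      rw [freedCount_insert_self G he₀ hd]
      exact hne.card_pos
    constructor
    · intro h
      rw [NimWin.eq_def] at h
      obtain ⟨e, he, hm⟩ := h
      rcases Finset.mem_insert.mp he with rfl | heS
      · rcases hm with ⟨_, hw⟩ | ⟨h0, _⟩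
        · rwa [Finset.erase_insert he₀] at hw
        · exact absurd h0 hpos.ne'
      · rw [NimWin.eq_def]
        exact ⟨e, heS, (move_iff e heS).mp hm⟩
    · intro h
      rw [NimWin.eq_def]
      refine ⟨e₀, Finset.mem_insert_self _ _, Or.inl ⟨hpos, ?_⟩⟩
      rwa [Finset.erase_insert he₀]

end Multigraph

/-- Let `H` be obtained from a multigraph `G` by adding two new coins `a`, `b`
and a single new string `e₀` joining `a` and `b`.  Then the first player has a
winning strategy in Nimstring on `H` iff the first player has a winning strategy
in Nimstring on `G`. -/
theorem nimstring_add_isolated_edge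
    (G H : Multigraph) (a b e₀ : ℕ)
    (hab : a ≠ b) (haV : a ∉ G.V) (hbV : b ∉ G.V) (he₀ : e₀ ∉ G.E)
    (hV : H.V = insert a (insert b G.V))
    (hE : H.E = insert e₀ G.E)
    (hends_old : ∀ e ∈ G.E, H.ends e = G.ends e)
    (hends_new : H.ends e₀ = {a, b}) :
    H.NimWin H.E ↔ G.NimWin G.E := by
  rw [hE, Multigraph.nimWin_insert_of_disjoint H (by simp [hends_new]) _ he₀ ?_,
    Multigraph.nimWin_congr _ hends_old]
  intro f hf
  rw [hends_new, hends_old f hf, Finset.disjoint_insert_left, Finset.disjoint_singleton_left]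
  exact ⟨fun h => haV (G.ends_sub f hf h), fun h => hbV (G.ends_sub f hf h)⟩
end

section
/- Let G be a multigraph and let H be obtained from G by attaching to every coin v of G a disjoint chain to the ground: four new coins c_1^v, c_2^v, c_3^v, c_4^v and five new strings v c_1^v, c_1^v c_2^v, c_2^v c_3^v, c_3^v c_4^v, and a string from c_4^v to the ground. Suppose a coin v of G has at least one incident string in G. Then for each of the five chain strings e attached to v, the first player has a winning strategy in Nimstring on H − e (the multigraph H with string e removed). -/
namespace Multigraph

/-- Coins-are-Lava: the player to move from position `S` has a winning strategy.
A string may be removed only if this frees no coin (a legal move); the first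
player without a legal move loses. -/
def LavaWin (G : Multigraph) (S : Finset ℕ) : Prop :=
  ∃ e, ∃ _h : e ∈ S, G.freedCount S e = 0 ∧ ¬ LavaWin G (S.erase e)
termination_by S.card
decreasing_by all_goals exact Finset.card_erase_lt_of_mem _h

/-- `G.ChainExtension H c s`: `H` is obtained from `G` by attaching to every coin
`v` of `G` a disjoint chain to the ground: four new coins `c v 0, …, c v 3` and
five new strings `s v 0, …, s v 4`, where `s v 0` joins `v` and `c v 0`,
`s v (i+1)` joins `c v i` and `c v (i+1)` for `i = 0, 1, 2`, and `s v 4` joins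
`c v 3` to the ground. -/
structure ChainExtension (G H : Multigraph) (c : ℕ → Fin 4 → ℕ) (s : ℕ → Fin 5 → ℕ) : Prop where
  c_inj : ∀ v ∈ G.V, ∀ w ∈ G.V, ∀ i j, c v i = c w j → v = w ∧ i = j
  c_new : ∀ v ∈ G.V, ∀ i, c v i ∉ G.V
  s_inj : ∀ v ∈ G.V, ∀ w ∈ G.V, ∀ i j, s v i = s w j → v = w ∧ i = j
  s_new : ∀ v ∈ G.V, ∀ i, s v i ∉ G.E
  hV : H.V = G.V ∪ G.V.biUnion fun v => Finset.univ.image (c v)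
  hE : H.E = G.E ∪ G.V.biUnion fun v => Finset.univ.image (s v)
  ends_old : ∀ e ∈ G.E, H.ends e = G.ends e
  ends0 : ∀ v ∈ G.V, H.ends (s v 0) = {v, c v 0}
  ends1 : ∀ v ∈ G.V, H.ends (s v 1) = {c v 0, c v 1}
  ends2 : ∀ v ∈ G.V, H.ends (s v 2) = {c v 1, c v 2}
  ends3 : ∀ v ∈ G.V, H.ends (s v 3) = {c v 2, c v 3}
  ends4 : ∀ v ∈ G.V, H.ends (s v 4) = {c v 3}

end Multigraph

namespace Multigraph

theorem freedCount_pos_iff {G : Multigraph} {S : Finset ℕ} {e : ℕ} :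
    0 < G.freedCount S e ↔ ∃ x ∈ G.ends e, ∀ f ∈ S, x ∈ G.ends f → f = e := by
  simp only [freedCount, freed, Finset.card_pos, Finset.Nonempty, Finset.mem_filter,
    Finset.mem_erase]
  grind

theorem freedCount_eq_zero_iff {G : Multigraph} {S : Finset ℕ} {e : ℕ} :
    G.freedCount S e = 0 ↔ ∀ x ∈ G.ends e, ∃ f ∈ S, x ∈ G.ends f ∧ f ≠ e := by
  rw [← not_iff_not, ← ne_eq, ← Nat.pos_iff_ne_zero, freedCount_pos_iff]
  grind

/-- If some string can be removed so as to free a coin and the resulting position is a win,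
then so is the original one. -/
theorem NimWin.of_capture {G : Multigraph} {S : Finset ℕ} {e : ℕ} (he : e ∈ S) (x : ℕ)
    (hx : x ∈ G.ends e) (honly : ∀ f ∈ S, x ∈ G.ends f → f = e)
    (hwin : G.NimWin (S.erase e)) : G.NimWin S := by
  rw [NimWin]
  exact ⟨e, he, .inl ⟨freedCount_pos_iff.2 ⟨x, hx, honly⟩, hwin⟩⟩

/-- A string that has an endpoint and shares no coin with the other strings
does not affect the outcome. -/
theorem nimWin_erase_isolated_iff {G : Multigraph} {f : ℕ} (hne : (G.ends f).Nonempty)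
    (S : Finset ℕ) (hf : f ∈ S)
    (hiso : ∀ e ∈ S, e ≠ f → ∀ x ∈ G.ends f, x ∉ G.ends e) :
    G.NimWin (S.erase f) ↔ G.NimWin S := by
  induction S using Finset.strongInduction with
  | H S ih =>
    have hcount : ∀ e ∈ S, e ≠ f → G.freedCount (S.erase f) e = G.freedCount S e := by
      intro e he hef
      unfold freedCount freed
      congr 1
      ext x
      simp only [Finset.mem_filter, Finset.mem_erase]
      grind
    have hrec : ∀ e ∈ S, e ≠ f →
        (G.NimWin ((S.erase f).erase e) ↔ G.NimWin (S.erase e)) := by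
      intro e he hef
      rw [Finset.erase_right_comm]
      exact ih _ (Finset.erase_ssubset he) (Finset.mem_erase.2 ⟨hef.symm, hf⟩)
        fun d hd => hiso d (Finset.mem_of_mem_erase hd)
    constructor
    · obtain ⟨x, hx⟩ := hne
      exact NimWin.of_capture hf x hx fun e he hxe => by_contra fun h => hiso e he h x hx hxe
    · intro h
      rw [NimWin] at h
      obtain ⟨e, he, h⟩ := h
      by_cases hef : e = f
      · subst hef
        rcases h with h | ⟨h0, -⟩
        · exact h.2
        · obtain ⟨x, hx⟩ := hne
          obtain ⟨d, hd, hxd, hde⟩ := freedCount_eq_zero_iff.1 h0 x hx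
          exact absurd hxd (hiso d hd hde x hx)
      · rw [NimWin]
        refine ⟨e, Finset.mem_erase.2 ⟨hef, he⟩, ?_⟩
        rwa [hcount e he hef, hrec e he hef]

/-- A loony position is a win: if `f` joins `x` to `y`, where `x` has no other string and the only
other string at `y` is `g`, and removing `g` frees no coin, then the player to move can either
capture both coins or give both of them away. -/
theorem nimWin_of_loony {G : Multigraph} {S : Finset ℕ} {f g x y : ℕ} (hf : f ∈ S) (hg : g ∈ S)
    (hfg : f ≠ g) (hends : G.ends f = {x, y}) (hyg : y ∈ G.ends g)
    (hx : ∀ e ∈ S, x ∈ G.ends e → e = f)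
    (hy : ∀ e ∈ S, y ∈ G.ends e → e = f ∨ e = g)
    (hfree : G.freedCount S g = 0) : G.NimWin S := by
  by_cases hwin : G.NimWin ((S.erase f).erase g)
  · refine NimWin.of_capture hf x (by simp [hends]) hx ?_
    refine NimWin.of_capture (Finset.mem_erase.2 ⟨hfg.symm, hg⟩) y hyg ?_ hwin
    intro e he hye
    rw [Finset.mem_erase] at he
    exact (hy e he.2 hye).resolve_left he.1
  · rw [NimWin]
    refine ⟨g, hg, .inr ⟨hfree, ?_⟩⟩
    rw [Finset.erase_right_comm, nimWin_erase_isolated_iff (by simp [hends]) _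
      (Finset.mem_erase.2 ⟨hfg, hf⟩)] at hwin
    · exact hwin
    · intro e he hef z hz hze
      rw [Finset.mem_erase] at he
      rw [hends, Finset.mem_insert, Finset.mem_singleton] at hz
      rcases hz with rfl | rfl
      · exact hef (hx e he.2 hze)
      · exact (hy e he.2 hze).elim hef he.1

namespace ChainExtension

variable {G H : Multigraph} {c : ℕ → Fin 4 → ℕ} {s : ℕ → Fin 5 → ℕ}

theorem string_mem (hext : G.ChainExtension H c s) {v : ℕ} (hv : v ∈ G.V) (i : Fin 5) :
    s v i ∈ H.E := by
  rw [hext.hE, Finset.mem_union, Finset.mem_biUnion]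
  exact .inr ⟨v, hv, Finset.mem_image_of_mem _ (Finset.mem_univ i)⟩

theorem string_ne (hext : G.ChainExtension H c s) {v : ℕ} (hv : v ∈ G.V) {i j : Fin 5}
    (hij : i ≠ j) : s v i ≠ s v j :=
  fun h => hij (hext.s_inj v hv v hv i j h).2

/-- The only strings at a chain coin are its two neighbours in the chain. -/
theorem eq_of_coin_mem_ends (hext : G.ChainExtension H c s) {v : ℕ} (hv : v ∈ G.V) (j : Fin 4)
    {e : ℕ} (he : e ∈ H.E) (hj : c v j ∈ H.ends e) : e = s v j.castSucc ∨ e = s v j.succ := by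
  rw [hext.hE, Finset.mem_union, Finset.mem_biUnion] at he
  rcases he with he | ⟨w, hw, he⟩
  · rw [hext.ends_old e he] at hj
    exact absurd (G.ends_sub e he hj) (hext.c_new v hv j)
  · obtain ⟨k, -, rfl⟩ := Finset.mem_image.1 he
    have hnew : c v j ≠ w := fun h => hext.c_new v hv j (h ▸ hw)
    have hinj := hext.c_inj v hv w hw j
    fin_cases k <;>
      simp only [Fin.zero_eta, Fin.mk_one, Fin.reduceFinMk, hext.ends0 w hw, hext.ends1 w hw,
        hext.ends2 w hw, hext.ends3 w hw, hext.ends4 w hw, Finset.mem_insert, Finset.mem_singleton,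
        hnew, false_or] at hj
    · obtain ⟨rfl, rfl⟩ := hinj _ hj
      exact .inl rfl
    · rcases hj with hj | hj <;> obtain ⟨rfl, rfl⟩ := hinj _ hj
      exacts [.inr rfl, .inl rfl]
    · rcases hj with hj | hj <;> obtain ⟨rfl, rfl⟩ := hinj _ hj
      exacts [.inr rfl, .inl rfl]
    · rcases hj with hj | hj <;> obtain ⟨rfl, rfl⟩ := hinj _ hj
      exacts [.inr rfl, .inl rfl]
    · obtain ⟨rfl, rfl⟩ := hinj _ hj
      exact .inr rfl

/-- A chain coin whose preceding string is missing can be captured. -/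
theorem nimWin_of_capture_succ (hext : G.ChainExtension H c s) {v : ℕ} (hv : v ∈ G.V)
    {S : Finset ℕ} (hS : S ⊆ H.E) (j : Fin 4) (hgone : s v j.castSucc ∉ S)
    (hmem : s v j.succ ∈ S) (hwin : H.NimWin (S.erase (s v j.succ))) : H.NimWin S := by
  refine NimWin.of_capture hmem (c v j) ?_ ?_ hwin
  · fin_cases j <;> simp [hext.ends1 v hv, hext.ends2 v hv, hext.ends3 v hv, hext.ends4 v hv]
  · intro f hf hcf
    exact (hext.eq_of_coin_mem_ends hv j (hS hf) hcf).resolve_left fun h => hgone (h ▸ hf)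

/-- A chain coin whose following string is missing can be captured. -/
theorem nimWin_of_capture_castSucc (hext : G.ChainExtension H c s) {v : ℕ} (hv : v ∈ G.V)
    {S : Finset ℕ} (hS : S ⊆ H.E) (j : Fin 4) (hgone : s v j.succ ∉ S)
    (hmem : s v j.castSucc ∈ S) (hwin : H.NimWin (S.erase (s v j.castSucc))) : H.NimWin S := by
  refine NimWin.of_capture hmem (c v j) ?_ ?_ hwin
  · fin_cases j <;> simp [hext.ends0 v hv, hext.ends1 v hv, hext.ends2 v hv, hext.ends3 v hv]
  · intro f hf hcf
    exact (hext.eq_of_coin_mem_ends hv j (hS hf) hcf).resolve_right fun h => hgone (h ▸ hf)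

/-- The last two coins of a chain, cut off from the rest of it, form a loony position. -/
theorem nimWin_of_ground_end (hext : G.ChainExtension H c s) {v : ℕ} (hv : v ∈ G.V)
    {S : Finset ℕ} (hS : S ⊆ H.E) (h2 : s v 2 ∉ S) (h3 : s v 3 ∈ S) (h4 : s v 4 ∈ S) :
    H.NimWin S := by
  have hne : s v 3 ≠ s v 4 := hext.string_ne hv (by decide)
  refine nimWin_of_loony h3 h4 hne (hext.ends3 v hv) (by simp [hext.ends4 v hv]) ?_ ?_ ?_
  · intro e he hc
    exact (hext.eq_of_coin_mem_ends hv 2 (hS he) hc).resolve_left fun h => h2 (h ▸ he)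
  · intro e he hc
    exact hext.eq_of_coin_mem_ends hv 3 (hS he) hc
  · rw [freedCount_eq_zero_iff, hext.ends4 v hv]
    intro x hx
    exact ⟨s v 3, h3, by simp_all [hext.ends3 v hv], hne⟩

/-- The first two coins of a chain, cut off from the rest of it, form a loony position
when the coin carrying the chain has another string. -/
theorem nimWin_of_coin_end (hext : G.ChainExtension H c s) {v : ℕ} (hv : v ∈ G.V)
    {S : Finset ℕ} (hS : S ⊆ H.E) (h0 : s v 0 ∈ S) (h1 : s v 1 ∈ S) (h2 : s v 2 ∉ S)
    (hdeg : ∃ e ∈ S, v ∈ H.ends e ∧ e ≠ s v 0) : H.NimWin S := by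
  have hne : s v 1 ≠ s v 0 := hext.string_ne hv (by decide)
  refine nimWin_of_loony h1 h0 hne ((hext.ends1 v hv).trans (Finset.pair_comm _ _))
    (by simp [hext.ends0 v hv]) ?_ ?_ ?_
  · intro e he hc
    exact (hext.eq_of_coin_mem_ends hv 1 (hS he) hc).resolve_right fun h => h2 (h ▸ he)
  · intro e he hc
    exact (hext.eq_of_coin_mem_ends hv 0 (hS he) hc).symm
  · rw [freedCount_eq_zero_iff, hext.ends0 v hv]
    intro x hx
    rw [Finset.mem_insert, Finset.mem_singleton] at hx
    rcases hx with rfl | rfl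
    · exact hdeg
    · exact ⟨s v 1, h1, by simp [hext.ends1 v hv], hne⟩

end ChainExtension

end Multigraph

/-- Let `H` be obtained from `G` by attaching to every coin of `G` a disjoint
length-5 chain to the ground, and let `v` be a coin of `G` with at least one
incident string in `G`.  Then for each of the five chain strings `s v i` attached
to `v`, the first player has a winning strategy in Nimstring on `H` minus that
string. -/
theorem nimstring_chains_minus_chain_string
    (G H : Multigraph) (c : ℕ → Fin 4 → ℕ) (s : ℕ → Fin 5 → ℕ)
    (hext : G.ChainExtension H c s)
    (v : ℕ) (hv : v ∈ G.V) (hdeg : ∃ e ∈ G.E, v ∈ G.ends e) :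
    ∀ i : Fin 5, H.NimWin (H.E.erase (s v i)) := by
  have hmem := hext.string_mem hv
  have hinj : ∀ i j, s v i = s v j ↔ i = j := fun i j =>
    ⟨fun h => (hext.s_inj v hv v hv i j h).2, fun h => h ▸ rfl⟩
  obtain ⟨e, he, hve⟩ := hdeg
  have heH : e ∈ H.E := by
    rw [hext.hE]
    exact Finset.mem_union_left _ he
  have hne : ∀ i, e ≠ s v i := fun i h => hext.s_new v hv i (h ▸ he)
  have hveH : v ∈ H.ends e := by rwa [hext.ends_old e he]
  have hsub : ∀ i, H.E.erase (s v i) ⊆ H.E := fun i => Finset.erase_subset _ _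
  intro i
  fin_cases i
  · refine hext.nimWin_of_capture_succ hv (hsub 0) 0 (by simp) (by simp [hmem, hinj]) ?_
    refine hext.nimWin_of_capture_succ hv ((Finset.erase_subset _ _).trans (hsub 0)) 1
      (by simp) (by simp [hmem, hinj]) ?_
    exact hext.nimWin_of_ground_end hv
      (((Finset.erase_subset _ _).trans (Finset.erase_subset _ _)).trans (hsub 0))
      (by simp) (by simp [hmem, hinj]) (by simp [hmem, hinj])
  · refine hext.nimWin_of_capture_succ hv (hsub 1) 1 (by simp) (by simp [hmem, hinj]) ?_
    exact hext.nimWin_of_ground_end hv ((Finset.erase_subset _ _).trans (hsub 1))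
      (by simp) (by simp [hmem, hinj]) (by simp [hmem, hinj])
  · exact hext.nimWin_of_ground_end hv (hsub 2)
      (by simp) (by simp [hmem, hinj]) (by simp [hmem, hinj])
  · refine hext.nimWin_of_capture_castSucc hv (hsub 3) 2 (by simp) (by simp [hmem, hinj]) ?_
    exact hext.nimWin_of_coin_end hv ((Finset.erase_subset _ _).trans (hsub 3))
      (by simp [hmem, hinj]) (by simp [hmem, hinj]) (by simp)
      ⟨e, by simp [heH, hne], hveH, hne 0⟩
  · refine hext.nimWin_of_capture_castSucc hv (hsub 4) 3 (by simp) (by simp [hmem, hinj]) ?_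
    refine hext.nimWin_of_capture_castSucc hv ((Finset.erase_subset _ _).trans (hsub 4)) 2
      (by simp) (by simp [hmem, hinj]) ?_
    exact hext.nimWin_of_coin_end hv
      (((Finset.erase_subset _ _).trans (Finset.erase_subset _ _)).trans (hsub 4))
      (by simp [hmem, hinj]) (by simp [hmem, hinj]) (by simp)
      ⟨e, by simp [heH, hne], hveH, hne 0⟩
end

section
/- Let F be a positive DNF formula over n variables, and consider GameSAT on F in which each player on their turn must assign a truth value to a currently-unset variable (no skipping), with a fixed choice of which player moves first. If Trudy has a winning strategy, then Trudy has a winning strategy in which every move she makes assigns the value true. -/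
/-- A positive DNF formula over variables `Fin n` is an OR of clauses, each an
AND of (unnegated) variables, represented as a list of finite sets of variables.
`evalDNF F s` evaluates `F` under the (partial) assignment `s`: some clause has
all its variables assigned `true`. -/
def evalDNF {n : ℕ} (F : List (Finset (Fin n))) (s : Fin n → Option Bool) : Bool :=
  F.any fun C => decide (∀ v ∈ C, s v = some true)

/-- Playing out GameSAT on the positive DNF formula `F` for `fuel` further moves
from partial assignment `s`, with `t = true` iff it is Trudy's turn.  Trudy
follows strategy `σ`, Fallon follows strategy `τ`; a strategy names, for the
current partial assignment, a variable together with the truth value to assign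
to it.  Each player must assign a value to a currently-unset variable (a player
naming an already-set variable cannot legally move and loses).  When the fuel is
exhausted (after `n` moves from the empty assignment all variables are set), the
result is whether Trudy wins: `true` iff `F` evaluates to true. -/
def playGameSAT {n : ℕ} (F : List (Finset (Fin n)))
    (σ τ : (Fin n → Option Bool) → Fin n × Bool) :
    ℕ → (Fin n → Option Bool) → Bool → Bool
  | 0, s, _ => evalDNF F s
  | fuel + 1, s, t =>
    let m := if t then σ s else τ s
    if s m.1 = none then
      playGameSAT F σ τ fuel (Function.update s m.1 (some m.2)) (!t)
    else !t

/-- Trudy wins GameSAT on `F` with `fuel` moves remaining from the partial assignment `s`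
(`t = true` iff it is her turn) when she is only allowed to assign the value `true`. -/
def TrudyWins {n : ℕ} (F : List (Finset (Fin n))) : ℕ → (Fin n → Option Bool) → Bool → Prop
  | 0, s, _ => evalDNF F s = true
  | fuel + 1, s, true => ∃ v, s v = none ∧ TrudyWins F fuel (Function.update s v (some true)) false
  | fuel + 1, s, false =>
    ∀ v, s v = none → ∀ b, TrudyWins F fuel (Function.update s v (some b)) true

/-- `TrudyWins` is preserved when some assigned values are raised from `false` to `true`. -/
theorem TrudyWins.mono {n : ℕ} {F : List (Finset (Fin n))} {fuel : ℕ}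
    {s s' : Fin n → Option Bool} {t : Bool} (hnone : ∀ v, s v = none ↔ s' v = none)
    (htrue : ∀ v, s v = some true → s' v = some true) (h : TrudyWins F fuel s t) :
    TrudyWins F fuel s' t := by
  induction fuel generalizing s s' t with
  | zero =>
    simp only [TrudyWins, evalDNF, List.any_eq_true, decide_eq_true_eq] at h ⊢
    obtain ⟨C, hC, hs⟩ := h
    exact ⟨C, hC, fun v hv => htrue v (hs v hv)⟩
  | succ fuel ih =>
    have step : ∀ v b t, TrudyWins F fuel (Function.update s v (some b)) t →
        TrudyWins F fuel (Function.update s' v (some b)) t := by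
      intro v b t
      apply ih <;> intro w <;> by_cases hw : w = v
      · simp [hw]
      · simpa [hw] using hnone w
      · simp [hw]
      · simpa [hw] using htrue w
    cases t with
    | true =>
      obtain ⟨v, hv, hw⟩ := h
      exact ⟨v, (hnone v).1 hv, step v true _ hw⟩
    | false => exact fun v hv b => step v b _ (h v ((hnone v).2 hv) b)

/-- Once `v` is assigned, only Fallon's choices at assignments setting `v` affect the play. -/
theorem playGameSAT_congr {n : ℕ} (F : List (Finset (Fin n)))
    (σ : (Fin n → Option Bool) → Fin n × Bool) {τ τ' : (Fin n → Option Bool) → Fin n × Bool}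
    {v : Fin n} (hτ : ∀ s, s v ≠ none → τ s = τ' s) (fuel : ℕ) {s : Fin n → Option Bool}
    (hs : s v ≠ none) (t : Bool) :
    playGameSAT F σ τ fuel s t = playGameSAT F σ τ' fuel s t := by
  induction fuel generalizing s t with
  | zero => rfl
  | succ fuel ih =>
    simp only [playGameSAT, hτ s hs]
    generalize (if t then σ s else τ' s) = m
    split
    · refine ih ?_ _
      rw [Function.update_apply]
      split
      · simp
      · exact hs
    · rfl

/-- If a strategy of Trudy beats every strategy of Fallon, then Trudy also wins by assigning
only `true`. -/
theorem trudyWins_of_forall_playGameSAT {n : ℕ} (F : List (Finset (Fin n)))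
    (σ : (Fin n → Option Bool) → Fin n × Bool) (fuel : ℕ) (s : Fin n → Option Bool) (t : Bool)
    (h : ∀ τ, playGameSAT F σ τ fuel s t = true) : TrudyWins F fuel s t := by
  induction fuel generalizing s t with
  | zero => exact h σ
  | succ fuel ih =>
    cases t with
    | true =>
      have hv : s (σ s).1 = none := by
        by_contra hv
        simpa [playGameSAT, hv] using h σ
      refine ⟨(σ s).1, hv, TrudyWins.mono
        (s := Function.update s (σ s).1 (some (σ s).2)) ?_ ?_ (ih _ _ fun τ => ?_)⟩
      · intro w
        by_cases hw : w = (σ s).1 <;> simp [hw]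
      · intro w
        by_cases hw : w = (σ s).1 <;> simp [hw]
      · simpa [playGameSAT, hv] using h τ
    | false =>
      intro v hv b
      refine ih _ _ fun τ => ?_
      rw [playGameSAT_congr F σ (τ' := Function.update τ s (v, b)) (v := v) _ fuel (by simp)]
      · simpa [playGameSAT, hv] using h (Function.update τ s (v, b))
      · intro s' hs'
        rw [Function.update_of_ne]
        rintro rfl
        exact hs' hv

/-- The number of variables left unset by a partial assignment. -/
def unsetCount {n : ℕ} (s : Fin n → Option Bool) : ℕ :=
  (Finset.univ.filter fun v => s v = none).card

theorem unsetCount_update {n : ℕ} {s : Fin n → Option Bool} {v : Fin n} (hv : s v = none)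
    (b : Bool) : unsetCount (Function.update s v (some b)) + 1 = unsetCount s := by
  have heq : (Finset.univ.filter fun w => Function.update s v (some b) w = none) =
      (Finset.univ.filter fun w => s w = none).erase v := by
    ext w
    by_cases hw : w = v <;> simp [Function.update_apply, hw]
  rw [unsetCount, unsetCount, heq]
  exact Finset.card_erase_add_one (by simpa using hv)

/-- A strategy choosing a winning variable whenever there is one beats every strategy of
Fallon from each position that is winning for Trudy. -/
theorem playGameSAT_of_trudyWins {n : ℕ} (F : List (Finset (Fin n)))
    {σ : (Fin n → Option Bool) → Fin n × Bool} (hσ : ∀ s, (σ s).2 = true)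
    (hwin : ∀ s, TrudyWins F (unsetCount s) s true → unsetCount s ≠ 0 →
      s (σ s).1 = none ∧
        TrudyWins F (unsetCount s - 1) (Function.update s (σ s).1 (some true)) false)
    (τ : (Fin n → Option Bool) → Fin n × Bool) (fuel : ℕ) (s : Fin n → Option Bool) (t : Bool)
    (hs : unsetCount s = fuel) (h : TrudyWins F fuel s t) :
    playGameSAT F σ τ fuel s t = true := by
  induction fuel generalizing s t with
  | zero => exact h
  | succ fuel ih =>
    have hcount : ∀ v b, s v = none →
        unsetCount (Function.update s v (some b)) = fuel := fun v b hv => by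
      have := unsetCount_update hv b
      omega
    cases t with
    | true =>
      obtain ⟨hv, hw⟩ := hwin s (hs ▸ h) (by omega)
      rw [hs, Nat.add_sub_cancel] at hw
      simpa [playGameSAT, hv, hσ] using ih _ _ (hcount _ _ hv) hw
    | false =>
      by_cases hv : s (τ s).1 = none
      · simpa [playGameSAT, hv] using ih _ _ (hcount _ _ hv) (h _ hv (τ s).2)
      · simp [playGameSAT, hv]

/-- GameSAT on a positive DNF formula `F` over `n` variables, with a fixed choice
`trudyFirst` of who moves first; players alternate, each assigning a truth value
to a currently-unset variable (no skipping); Trudy wins iff `F` is true at the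
end.  If Trudy has a winning strategy, then she has a winning strategy in which
every move she makes assigns the value `true`. -/
theorem trudy_can_always_play_true {n : ℕ} (F : List (Finset (Fin n)))
    (trudyFirst : Bool)
    (h : ∃ σ, ∀ τ, playGameSAT F σ τ n (fun _ => none) trudyFirst = true) :
    ∃ σ, (∀ s, (σ s).2 = true) ∧
      ∀ τ, playGameSAT F σ τ n (fun _ => none) trudyFirst = true := by
  obtain ⟨σ₀, h₀⟩ := h
  have hex : ∀ s : Fin n → Option Bool, ∃ v : Fin n,
      TrudyWins F (unsetCount s) s true → unsetCount s ≠ 0 →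
        s v = none ∧
          TrudyWins F (unsetCount s - 1) (Function.update s v (some true)) false := by
    intro s
    generalize unsetCount s = k
    by_cases hs : TrudyWins F k s true
    · cases k with
      | zero => exact ⟨(σ₀ s).1, fun _ h0 => absurd rfl h0⟩
      | succ k =>
        obtain ⟨v, hv⟩ := hs
        exact ⟨v, fun _ _ => hv⟩
    · exact ⟨(σ₀ s).1, fun h => absurd h hs⟩
  choose f hf using hex
  refine ⟨fun s => (f s, true), fun _ => rfl, fun τ => ?_⟩
  exact playGameSAT_of_trudyWins F (fun _ => rfl) hf τ n _ _ (by simp [unsetCount])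
    (trudyWins_of_forall_playGameSAT F σ₀ n _ _ h₀)
end
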